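/- arXiv:quant-ph/0505090 — 2 statements merged into one kernel-verified Lean document; each statement's English description precedes it below -/
import Mathlib

section
/- Let I be an instrument with finite outcome set Ω, operations O(ω) and outcome probabilities p_ρ(ω). Let ρ be a density matrix and φ a positive definite density matrix. Then S_c(p_ρ‖p_φ) + Σ_{ω: p_ρ(ω)>0} p_ρ(ω) S_q(π_ρ(ω)‖π_φ(ω)) ≥ S_q(I(Ω)[ρ]‖I(Ω)[φ]), where I(Ω)[τ] = Σ_{ω∈Ω} O(ω)[τ] is the unconditional post-measurement state map and π_ρ(ω), π_φ(ω) are the a posteriori states. -/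
open Matrix Finset
open scoped BigOperators ComplexOrder

noncomputable section

/-- Matrix logarithm of a Hermitian matrix via the spectral decomposition
(with the convention `Real.log 0 = 0` on the kernel); `0` for non-Hermitian matrices. -/
def matLog {d : ℕ} (A : Matrix (Fin d) (Fin d) ℂ) : Matrix (Fin d) (Fin d) ℂ :=
  if hA : A.IsHermitian then
    (hA.eigenvectorUnitary : Matrix (Fin d) (Fin d) ℂ) *
      Matrix.diagonal (fun i => (Real.log (hA.eigenvalues i) : ℂ)) *
      star (hA.eigenvectorUnitary : Matrix (Fin d) (Fin d) ℂ)
  else 0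

/-- The von Neumann entropy `S_q(ρ) = −Tr(ρ log ρ)`. -/
def vnEntropy {d : ℕ} (ρ : Matrix (Fin d) (Fin d) ℂ) : ℝ :=
  -(Matrix.trace (ρ * matLog ρ)).re

/-- The quantum relative entropy `S_q(ρ‖φ) = Tr(ρ (log ρ − log φ))`. -/
def qRelEntropy {d : ℕ} (ρ φ : Matrix (Fin d) (Fin d) ℂ) : ℝ :=
  (Matrix.trace (ρ * (matLog ρ - matLog φ))).re

/-- The classical relative entropy `S_c(p‖q) = Σ_{ω : p ω > 0} p ω log (p ω / q ω)`. -/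
def cRelEntropy {Ω : Type*} [Fintype Ω] (p q : Ω → ℝ) : ℝ :=
  ∑ ω ∈ Finset.univ.filter (fun ω => 0 < p ω), p ω * Real.log (p ω / q ω)

/-- The probability of outcome `ω` for POV measure `E` in the state `ρ`. -/
def povProb {d : ℕ} {Ω : Type*} (E : Ω → Matrix (Fin d) (Fin d) ℂ)
    (ρ : Matrix (Fin d) (Fin d) ℂ) (ω : Ω) : ℝ :=
  (Matrix.trace (E ω * ρ)).re

/-- The χ-quantity of the ensemble `{p, σ}` (relative entropies w.r.t. the average state). -/
def chiQuantity {d : ℕ} {X : Type*} [Fintype X] (p : X → ℝ)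
    (σ : X → Matrix (Fin d) (Fin d) ℂ) : ℝ :=
  ∑ x ∈ Finset.univ.filter (fun x => 0 < p x),
    p x * qRelEntropy (σ x) (∑ y, p y • σ y)

/-- The operation `O(ω)[ρ] = Σ_k V_k^ω ρ (V_k^ω)†` of the instrument with Kraus family `V`. -/
def instrOp {d : ℕ} {Ω K : Type*} [Fintype K] (V : Ω → K → Matrix (Fin d) (Fin d) ℂ)
    (ω : Ω) (ρ : Matrix (Fin d) (Fin d) ℂ) : Matrix (Fin d) (Fin d) ℂ :=
  ∑ k, V ω k * ρ * (V ω k)ᴴ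

/-- The POV measure `E(ω) = Σ_k (V_k^ω)† V_k^ω` associated with the instrument `V`. -/
def instrPOV {d : ℕ} {Ω K : Type*} [Fintype K] (V : Ω → K → Matrix (Fin d) (Fin d) ℂ)
    (ω : Ω) : Matrix (Fin d) (Fin d) ℂ :=
  ∑ k, (V ω k)ᴴ * V ω k

/-- The outcome probability `p_ρ(ω) = Tr(E(ω) ρ)` of the instrument `V`. -/
def outcomeProb {d : ℕ} {Ω K : Type*} [Fintype K] (V : Ω → K → Matrix (Fin d) (Fin d) ℂ)
    (ρ : Matrix (Fin d) (Fin d) ℂ) (ω : Ω) : ℝ :=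
  (Matrix.trace (instrPOV V ω * ρ)).re

/-- The a posteriori state `π_ρ(ω) = O(ω)[ρ] / p_ρ(ω)` of the instrument `V`. -/
def postState {d : ℕ} {Ω K : Type*} [Fintype K] (V : Ω → K → Matrix (Fin d) (Fin d) ℂ)
    (ρ : Matrix (Fin d) (Fin d) ℂ) (ω : Ω) : Matrix (Fin d) (Fin d) ℂ :=
  (outcomeProb V ρ ω)⁻¹ • instrOp V ω ρ

/-- The classical input/output mutual information `I_c{p, ρ; E}` for the ensemble `{p, ρ}`
measured with the POV measure `E`. -/
def mutualInfo {d : ℕ} {A Ω : Type*} [Fintype A] [Fintype Ω]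
    (p : A → ℝ) (ρ : A → Matrix (Fin d) (Fin d) ℂ)
    (E : Ω → Matrix (Fin d) (Fin d) ℂ) : ℝ :=
  ∑ x ∈ Finset.univ.filter (fun x : A × Ω => 0 < p x.1 * povProb E (ρ x.1) x.2),
    (p x.1 * povProb E (ρ x.1) x.2) *
      Real.log ((p x.1 * povProb E (ρ x.1) x.2) /
        (p x.1 * povProb E (∑ α, p α • ρ α) x.2))

/-- The quantum information gain `I_q(ρ; I)` of the instrument `V` on the state `ρ`. -/
def infoGain {d : ℕ} {Ω K : Type*} [Fintype Ω] [Fintype K]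
    (V : Ω → K → Matrix (Fin d) (Fin d) ℂ) (ρ : Matrix (Fin d) (Fin d) ℂ) : ℝ :=
  vnEntropy ρ - ∑ ω ∈ Finset.univ.filter (fun ω => 0 < outcomeProb V ρ ω),
    outcomeProb V ρ ω * vnEntropy (postState V ρ ω)

/-- A pure state: a rank-one orthogonal projection. -/
def IsPureState {d : ℕ} (ρ : Matrix (Fin d) (Fin d) ℂ) : Prop :=
  ρ.IsHermitian ∧ ρ * ρ = ρ ∧ ρ.rank = 1

end

section SpectralForm

variable {n : Type*} [Fintype n]

/-- The concave quadratic functional of `X` whose supremum is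
`⟨A, (L_B + t R_A)⁻¹ A⟩` for the left and right multiplications `L_B`, `R_A`. -/
def resolventFunctional (t : ℝ) (A B X : Matrix n n ℂ) : ℝ :=
  2 * (trace (star X * A)).re - (trace (star X * B * X)).re - t * (trace (X * A * star X)).re

theorem resolventFunctional_sum {ι : Type*} [Fintype ι] (t : ℝ) (A B : ι → Matrix n n ℂ)
    (X : Matrix n n ℂ) :
    resolventFunctional t (∑ ω, A ω) (∑ ω, B ω) X =
      ∑ ω, resolventFunctional t (A ω) (B ω) X := by
  simp only [resolventFunctional, Matrix.sum_mul, trace_sum, Complex.re_sum,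
    Finset.mul_sum, Finset.sum_sub_distrib]

variable [DecidableEq n]

/-- The matrix with eigenvalues `a` and eigenvectors the columns of `U`. -/
def spectralForm (U : Matrix n n ℂ) (a : n → ℝ) : Matrix n n ℂ :=
  U * diagonal (fun i => (a i : ℂ)) * star U

/-- The squared overlap of the `i`-th column of `U` with the `j`-th column of `W`. -/
def overlap (U W : Matrix n n ℂ) (i j : n) : ℝ :=
  Complex.normSq ((star W * U) j i)

theorem isHermitian_spectralForm (U : Matrix n n ℂ) (a : n → ℝ) :
    (spectralForm U a).IsHermitian := by
  have h : (diagonal fun i => (a i : ℂ)).IsHermitian := by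
    ext i j
    by_cases hij : i = j
    · subst hij; simp
    · simp [diagonal_apply_ne _ hij, diagonal_apply_ne _ (Ne.symm hij)]
  simpa [spectralForm, star_eq_conjTranspose] using isHermitian_mul_mul_conjTranspose U h

theorem smul_spectralForm (c : ℝ) (U : Matrix n n ℂ) (a : n → ℝ) :
    c • spectralForm U a = spectralForm U (fun i => c * a i) := by
  have : (diagonal fun i => ((c * a i : ℝ) : ℂ)) = c • diagonal fun i => (a i : ℂ) := by
    rw [← diagonal_smul]
    congr 1
    ext i
    simp
  rw [spectralForm, spectralForm, this, mul_smul_comm, smul_mul_assoc]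

theorem Matrix.PosSemidef.exists_spectralForm {A : Matrix n n ℂ} (hA : A.PosSemidef) :
    ∃ U : Matrix n n ℂ, ∃ a : n → ℝ, star U * U = 1 ∧ U * star U = 1 ∧ (∀ i, 0 ≤ a i) ∧
      A = spectralForm U a := by
  refine ⟨hA.1.eigenvectorUnitary, hA.1.eigenvalues, Unitary.coe_star_mul_self _,
    Unitary.coe_mul_star_self _, hA.eigenvalues_nonneg, ?_⟩
  conv_lhs => rw [hA.1.spectral_theorem]
  rfl

/-- A function of the spectrum does not depend on the choice of the diagonalization. -/
theorem spectralForm_comp_eq {U W : Matrix n n ℂ} {a b : n → ℝ}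
    (hU : star U * U = 1) (hU' : U * star U = 1) (hW : star W * W = 1) (hW' : W * star W = 1)
    (h : spectralForm U a = spectralForm W b) (f : ℝ → ℝ) :
    spectralForm U (fun i => f (a i)) = spectralForm W (fun i => f (b i)) := by
  have key : (star W * U) * diagonal (fun i => (a i : ℂ)) =
      diagonal (fun i => (b i : ℂ)) * (star W * U) := by
    have h2 := congrArg (fun X => star W * X * U) h
    simp only [spectralForm] at h2
    calc _ = star W * (U * diagonal (fun i => (a i : ℂ)) * star U) * U := by
            simp only [Matrix.mul_assoc, hU, Matrix.mul_one]
      _ = (star W * W) * diagonal (fun i => (b i : ℂ)) * (star W * U) := by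
            rw [h2]; simp only [Matrix.mul_assoc]
      _ = _ := by rw [hW, Matrix.one_mul]
  have key' : (star W * U) * diagonal (fun i => (f (a i) : ℂ)) =
      diagonal (fun i => (f (b i) : ℂ)) * (star W * U) := by
    ext j i
    have h3 := congrFun (congrFun key j) i
    rw [mul_diagonal, diagonal_mul] at h3 ⊢
    by_cases h0 : (star W * U) j i = 0
    · simp [h0]
    · have : a i = b j := by
        rw [mul_comm] at h3
        exact_mod_cast mul_right_cancel₀ h0 h3
      rw [this, mul_comm]
  have h4 := congrArg (fun X => W * X * star U) key'
  calc spectralForm U (fun i => f (a i))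
      = (W * star W) * U * diagonal (fun i => (f (a i) : ℂ)) * star U := by
          rw [hW', Matrix.one_mul]; rfl
    _ = W * diagonal (fun i => (f (b i) : ℂ)) * star W * (U * star U) := by
          simpa only [Matrix.mul_assoc] using h4
    _ = _ := by rw [hU', Matrix.mul_one]; rfl

theorem matLog_spectralForm {d : ℕ} {U : Matrix (Fin d) (Fin d) ℂ} {a : Fin d → ℝ}
    (hU : star U * U = 1) (hU' : U * star U = 1) :
    matLog (spectralForm U a) = spectralForm U (fun i => Real.log (a i)) := by
  have hA := isHermitian_spectralForm U a
  rw [matLog, dif_pos hA]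
  refine spectralForm_comp_eq (Unitary.coe_star_mul_self _) (Unitary.coe_mul_star_self _)
    hU hU' ?_ Real.log
  conv_rhs => rw [hA.spectral_theorem]
  rfl

theorem trace_spectralForm_mul (U W : Matrix n n ℂ) (a c : n → ℝ) :
    (trace (spectralForm U a * spectralForm W c)).re =
      ∑ i, ∑ j, overlap U W i j * (a i * c j) := by
  have h : trace (spectralForm U a * spectralForm W c) =
      trace ((star W * U) * diagonal (fun i => (a i : ℂ)) * star (star W * U) *
        diagonal (fun i => (c i : ℂ))) := by
    simp only [spectralForm, StarMul.star_mul, star_star]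
    rw [← Matrix.mul_assoc, Matrix.trace_mul_comm]
    simp only [Matrix.mul_assoc]
  rw [h, Finset.sum_comm]
  simp only [trace, diag_apply, mul_diagonal, Complex.re_sum]
  refine Finset.sum_congr rfl fun j _ => ?_
  rw [Matrix.mul_apply, Finset.sum_mul, Complex.re_sum]
  refine Finset.sum_congr rfl fun i _ => ?_
  simp only [mul_diagonal, star_apply, overlap, Complex.normSq_apply]
  simp
  ring

theorem sum_overlap {U W : Matrix n n ℂ} (hU : star U * U = 1) (hW' : W * star W = 1) (i : n) :
    ∑ j, overlap U W i j = 1 := by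
  have h : star (star W * U) * (star W * U) = 1 := by
    calc _ = star U * (W * star W) * U := by
          simp only [StarMul.star_mul, star_star, Matrix.mul_assoc]
      _ = 1 := by rw [hW', Matrix.mul_one, hU]
  have h2 := congrArg Complex.re (congrFun (congrFun h i) i)
  rw [Matrix.mul_apply, Complex.re_sum] at h2
  simp only [one_apply_eq, Complex.one_re] at h2
  rw [← h2]
  refine Finset.sum_congr rfl fun j _ => ?_
  simp only [star_apply, overlap, Complex.normSq_apply]
  simp

theorem trace_spectralForm {U W : Matrix n n ℂ} (hU : star U * U = 1) (hW' : W * star W = 1)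
    (a : n → ℝ) : (trace (spectralForm U a)).re = ∑ i, ∑ j, overlap U W i j * a i := by
  simp only [← Finset.sum_mul, sum_overlap hU hW', one_mul]
  rw [spectralForm, Matrix.trace_mul_comm, ← Matrix.mul_assoc, hU, Matrix.one_mul]
  simp [trace]

theorem qRelEntropy_spectralForm {d : ℕ} {U W : Matrix (Fin d) (Fin d) ℂ} {a b : Fin d → ℝ}
    (hU : star U * U = 1) (hU' : U * star U = 1) (hW : star W * W = 1) (hW' : W * star W = 1) :
    qRelEntropy (spectralForm U a) (spectralForm W b) =
      ∑ i, ∑ j, overlap U W i j * (a i * (Real.log (a i) - Real.log (b j))) := by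
  have h : spectralForm U a * spectralForm U (fun i => Real.log (a i)) =
      spectralForm U (fun i => a i * Real.log (a i)) := by
    calc _ = U * diagonal (fun i => (a i : ℂ)) * (star U * U) *
          diagonal (fun i => (Real.log (a i) : ℂ)) * star U := by
            simp only [spectralForm, Matrix.mul_assoc]
      _ = _ := by
          rw [hU, Matrix.mul_one, Matrix.mul_assoc U, diagonal_mul_diagonal, spectralForm]
          simp
  rw [qRelEntropy, matLog_spectralForm hU hU', matLog_spectralForm hW hW', mul_sub, h,
    trace_sub, Complex.sub_re, trace_spectralForm hU hW', trace_spectralForm_mul,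
    ← Finset.sum_sub_distrib]
  refine Finset.sum_congr rfl fun i _ => ?_
  rw [← Finset.sum_sub_distrib]
  exact Finset.sum_congr rfl fun j _ => by ring

theorem overlap_mul_eq_zero_of_ker_le {U W : Matrix n n ℂ} {a b : n → ℝ}
    (hU : star U * U = 1) (hW : star W * W = 1)
    (h : ∀ v, spectralForm W b *ᵥ v = 0 → spectralForm U a *ᵥ v = 0) {i j : n}
    (hj : b j = 0) : overlap U W i j * a i = 0 := by
  have h1 : spectralForm W b *ᵥ (W *ᵥ Pi.single j 1) = 0 := by
    rw [mulVec_mulVec, spectralForm, Matrix.mul_assoc, hW, Matrix.mul_one, ← mulVec_mulVec,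
      diagonal_mulVec_single]
    simp [hj]
  have h2 := congrArg (fun v => star U *ᵥ v) (h _ h1)
  simp only [spectralForm, mulVec_mulVec, mulVec_zero] at h2
  have h3 : star U * (U * diagonal (fun i => (a i : ℂ)) * star U * W) =
      diagonal (fun i => (a i : ℂ)) * star (star W * U) := by
    simp only [Matrix.mul_assoc, StarMul.star_mul, star_star]
    rw [← Matrix.mul_assoc, hU, Matrix.one_mul]
  rw [h3] at h2
  have h4 := congrFun h2 i
  simp only [mulVec_single_one, col_apply, diagonal_mul, star_apply, Pi.zero_apply] at h4
  rcases mul_eq_zero.mp h4 with h5 | h5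
  · simp [Complex.ofReal_eq_zero.mp h5]
  · simp [overlap, star_eq_zero.mp h5]

theorem resolventFunctional_spectralForm {U W : Matrix n n ℂ} {a b : n → ℝ} (t : ℝ)
    (hU : star U * U = 1) (hW : star W * W = 1) (Y : Matrix n n ℂ) :
    resolventFunctional t (spectralForm U a) (spectralForm W b) (W * Y * star U) =
      ∑ i, ∑ j, (2 * a i * (star (Y j i) * (star W * U) j i).re -
        (b j + t * a i) * Complex.normSq (Y j i)) := by
  have h1 : trace (star (W * Y * star U) * spectralForm U a) =
      trace (star Y * ((star W * U) * diagonal (fun i => (a i : ℂ)))) := by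
    calc _ = trace (U * (star Y * star W * U * diagonal (fun i => (a i : ℂ)) * star U)) := by
          simp only [spectralForm, StarMul.star_mul, star_star, Matrix.mul_assoc]
      _ = _ := by
          rw [Matrix.trace_mul_comm, Matrix.mul_assoc, hU, Matrix.mul_one]
          simp only [Matrix.mul_assoc]
  have h2 : trace (star (W * Y * star U) * spectralForm W b * (W * Y * star U)) =
      trace (star Y * (diagonal (fun i => (b i : ℂ)) * Y)) := by
    calc _ = trace (U * (star Y * (star W * W) * diagonal (fun i => (b i : ℂ)) *
          (star W * W) * Y * star U)) := by
          simp only [spectralForm, StarMul.star_mul, star_star, Matrix.mul_assoc]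
      _ = _ := by
          rw [Matrix.trace_mul_comm, Matrix.mul_assoc, hU, hW, Matrix.mul_one]
          simp only [Matrix.mul_assoc, Matrix.one_mul]
  have h3 : trace ((W * Y * star U) * spectralForm U a * star (W * Y * star U)) =
      trace (star Y * (Y * diagonal (fun i => (a i : ℂ)))) := by
    calc _ = trace (W * (Y * (star U * U) * diagonal (fun i => (a i : ℂ)) *
          (star U * U) * star Y * star W)) := by
          simp only [spectralForm, StarMul.star_mul, star_star, Matrix.mul_assoc]
      _ = trace ((Y * diagonal (fun i => (a i : ℂ))) * star Y) := by
          rw [Matrix.trace_mul_comm, Matrix.mul_assoc, hU, hW, Matrix.mul_one]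
          simp only [Matrix.mul_assoc, Matrix.mul_one]
      _ = _ := Matrix.trace_mul_comm _ _
  rw [resolventFunctional, h1, h2, h3]
  simp only [trace, diag_apply, Complex.re_sum, Finset.mul_sum, ← Finset.sum_sub_distrib]
  refine Finset.sum_congr rfl fun i _ => ?_
  rw [Matrix.mul_apply, Matrix.mul_apply, Matrix.mul_apply, Complex.re_sum, Complex.re_sum,
    Complex.re_sum, Finset.mul_sum, Finset.mul_sum, ← Finset.sum_sub_distrib,
    ← Finset.sum_sub_distrib]
  refine Finset.sum_congr rfl fun j _ => ?_
  simp only [mul_diagonal, diagonal_mul, star_apply, Complex.normSq_apply]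
  simp
  ring

theorem resolventFunctional_le {U W : Matrix n n ℂ} {a b : n → ℝ} {t : ℝ} (ht : 0 < t)
    (hU : star U * U = 1) (hW : star W * W = 1) (hW' : W * star W = 1)
    (ha : ∀ i, 0 ≤ a i) (hb : ∀ j, 0 ≤ b j) (X : Matrix n n ℂ) :
    resolventFunctional t (spectralForm U a) (spectralForm W b) X ≤
      ∑ i, ∑ j, overlap U W i j * (a i * (a i / (b j + t * a i))) := by
  have hU' : U * star U = 1 := mul_eq_one_comm.mp hU
  have hX : X = W * (star W * X * U) * star U := by
    calc X = (W * star W) * X * (U * star U) := by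
          rw [hU', hW', Matrix.one_mul, Matrix.mul_one]
      _ = _ := by simp only [Matrix.mul_assoc]
  rw [hX, resolventFunctional_spectralForm t hU hW]
  refine Finset.sum_le_sum fun i _ => Finset.sum_le_sum fun j _ => ?_
  generalize (star W * X * U) j i = y
  rw [overlap]
  generalize (star W * U) j i = m
  rcases (ha i).eq_or_lt with h0 | h0
  · simp only [← h0]
    have := mul_nonneg (hb j) (Complex.normSq_nonneg y)
    simp
    linarith
  · have hpos : 0 < b j + t * a i := by have := hb j; positivity
    generalize b j + t * a i = c at hpos
    rw [← sub_nonneg]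
    have : Complex.normSq m * (a i * (a i / c)) -
        (2 * a i * (star y * m).re - c * Complex.normSq y) =
        ((a i * m.re - c * y.re) ^ 2 + (a i * m.im - c * y.im) ^ 2) / c := by
      simp only [Complex.normSq_apply, Complex.mul_re, RCLike.star_def, Complex.conj_re,
        Complex.conj_im]
      field_simp
      ring
    rw [this]
    positivity

theorem exists_resolventFunctional_eq {U W : Matrix n n ℂ} {a b : n → ℝ} {t : ℝ} (ht : 0 < t)
    (hU : star U * U = 1) (hW : star W * W = 1)
    (ha : ∀ i, 0 ≤ a i) (hb : ∀ j, 0 ≤ b j) :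
    ∃ X, resolventFunctional t (spectralForm U a) (spectralForm W b) X =
      ∑ i, ∑ j, overlap U W i j * (a i * (a i / (b j + t * a i))) := by
  refine ⟨W * (Matrix.of fun j i => ((a i / (b j + t * a i) : ℝ) : ℂ) * (star W * U) j i) *
    star U, ?_⟩
  rw [resolventFunctional_spectralForm t hU hW]
  refine Finset.sum_congr rfl fun i _ => Finset.sum_congr rfl fun j _ => ?_
  rw [overlap, Matrix.of_apply]
  generalize (star W * U) j i = m
  rcases (ha i).eq_or_lt with h0 | h0
  · simp [← h0]
  · have hpos : 0 < b j + t * a i := by have := hb j; positivity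
    generalize b j + t * a i = c at hpos
    simp only [Complex.normSq_apply, Complex.mul_re, Complex.mul_im, RCLike.star_def,
      Complex.conj_re, Complex.conj_im, Complex.ofReal_re, Complex.ofReal_im]
    field_simp
    ring

end SpectralForm

section LogResolvent

theorem hasDerivAt_log_resolvent {a b t : ℝ} (w : ℝ) (ha : 0 ≤ a) (hb : 0 ≤ b) (ht : 0 < t) :
    HasDerivAt (fun s => w * (a * (Real.log (b + s * a) - Real.log b)))
      (w * (a * (a / (b + t * a)))) t := by
  rcases ha.eq_or_lt with rfl | h0
  · simpa using hasDerivAt_const t (0 : ℝ)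
  · have hpos : 0 < b + t * a := by positivity
    have h : HasDerivAt (fun s => b + s * a) a t := by
      simpa using ((hasDerivAt_id t).mul_const a).const_add b
    exact (((h.log hpos.ne').sub_const _).const_mul a).const_mul w

theorem continuousOn_log_resolvent {w a b : ℝ} (ha : 0 ≤ a) (hb : 0 ≤ b)
    (h : b = 0 → w * a = 0) :
    ContinuousOn (fun s => w * (a * (Real.log (b + s * a) - Real.log b))) (Set.Ici 0) := by
  rcases hb.eq_or_lt with h0 | h0
  · simp only [← mul_assoc, h h0.symm, zero_mul]
    exact continuousOn_const
  · refine continuousOn_const.mul (continuousOn_const.mul (ContinuousOn.sub ?_ continuousOn_const))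
    refine ContinuousOn.log (by fun_prop) fun s hs => ?_
    have : 0 ≤ s := hs
    positivity

open Filter Topology in
theorem tendsto_log_resolvent {w a b : ℝ} (ha : 0 ≤ a) (hb : 0 ≤ b) :
    Tendsto (fun s => w * (a * (Real.log (b + s * a) - Real.log b)) - Real.log s * (w * a))
      atTop (𝓝 (w * (a * (Real.log a - Real.log b)))) := by
  rcases ha.eq_or_lt with rfl | h0
  · simp
  have h1 : Tendsto (fun s : ℝ => b * s⁻¹ + a) atTop (𝓝 a) := by
    simpa using (tendsto_inv_atTop_zero.const_mul b).add_const a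
  have h2 := ((((Real.continuousAt_log h0.ne').tendsto.comp h1).sub_const
    (Real.log b)).const_mul a).const_mul w
  refine h2.congr' ?_
  filter_upwards [eventually_gt_atTop 0] with s hs
  have h3 : Real.log (b + s * a) = Real.log s + Real.log (b * s⁻¹ + a) := by
    rw [← Real.log_mul hs.ne' (by positivity)]
    congr 1
    field_simp
  simp only [Function.comp_apply, h3]
  ring

end LogResolvent

section Subadditivity

variable {d : ℕ}

open Filter Topology in
/-- Joint subadditivity of the quantum relative entropy on positive semidefinite matrices. -/
theorem qRelEntropy_sum_le {ι : Type*} [Fintype ι] {A B : ι → Matrix (Fin d) (Fin d) ℂ}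
    (hA : ∀ ω, (A ω).PosSemidef) (hB : ∀ ω, (B ω).PosSemidef)
    (hker : ∀ ω v, B ω *ᵥ v = 0 → A ω *ᵥ v = 0) :
    qRelEntropy (∑ ω, A ω) (∑ ω, B ω) ≤ ∑ ω, qRelEntropy (A ω) (B ω) := by
  have hkerS : ∀ v, (∑ ω, B ω) *ᵥ v = 0 → (∑ ω, A ω) *ᵥ v = 0 := by
    intro v hv
    have h1 : ∑ ω, star v ⬝ᵥ (B ω *ᵥ v) = 0 := by
      rw [← dotProduct_sum, ← Matrix.sum_mulVec, hv, dotProduct_zero]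
    rw [Finset.sum_eq_zero_iff_of_nonneg fun ω _ => (hB ω).dotProduct_mulVec_nonneg v] at h1
    rw [Matrix.sum_mulVec]
    exact Finset.sum_eq_zero fun ω hω =>
      hker ω v (((hB ω).dotProduct_mulVec_zero_iff v).mp (h1 ω hω))
  obtain ⟨U₀, a₀, hU₀, hU₀', ha₀, hA₀⟩ :=
    (posSemidef_sum Finset.univ fun ω _ => hA ω).exists_spectralForm
  obtain ⟨W₀, b₀, hW₀, hW₀', hb₀, hB₀⟩ :=
    (posSemidef_sum Finset.univ fun ω _ => hB ω).exists_spectralForm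
  choose U a hU hU' ha hAeq using fun ω => (hA ω).exists_spectralForm
  choose W b hW hW' hb hBeq using fun ω => (hB ω).exists_spectralForm
  have hs₀ : ∀ i j, b₀ j = 0 → overlap U₀ W₀ i j * a₀ i = 0 := fun i j hj =>
    overlap_mul_eq_zero_of_ker_le hU₀ hW₀ (by rwa [← hA₀, ← hB₀]) hj
  have hs : ∀ ω i j, b ω j = 0 → overlap (U ω) (W ω) i j * a ω i = 0 := fun ω i j hj =>
    overlap_mul_eq_zero_of_ker_le (hU ω) (hW ω) (by rw [← hAeq, ← hBeq]; exact hker ω) hj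
  let g₀ : ℝ → ℝ := fun s => ∑ i, ∑ j,
    overlap U₀ W₀ i j * (a₀ i * (Real.log (b₀ j + s * a₀ i) - Real.log (b₀ j)))
  let g : ι → ℝ → ℝ := fun ω s => ∑ i, ∑ j, overlap (U ω) (W ω) i j *
    (a ω i * (Real.log (b ω j + s * a ω i) - Real.log (b ω j)))
  have hderiv : ∀ t, 0 < t → HasDerivAt (fun s => (∑ ω, g ω s) - g₀ s)
      ((∑ ω, ∑ i, ∑ j, overlap (U ω) (W ω) i j *
        (a ω i * (a ω i / (b ω j + t * a ω i)))) -
        ∑ i, ∑ j, overlap U₀ W₀ i j * (a₀ i * (a₀ i / (b₀ j + t * a₀ i)))) t := fun t ht =>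
    (HasDerivAt.fun_sum fun ω _ => HasDerivAt.fun_sum fun i _ => HasDerivAt.fun_sum fun j _ =>
      hasDerivAt_log_resolvent _ (ha ω i) (hb ω j) ht).sub
    (HasDerivAt.fun_sum fun i _ => HasDerivAt.fun_sum fun j _ =>
      hasDerivAt_log_resolvent _ (ha₀ i) (hb₀ j) ht)
  have hmono : MonotoneOn (fun s => (∑ ω, g ω s) - g₀ s) (Set.Ici 0) := by
    refine monotoneOn_of_deriv_nonneg (convex_Ici 0) ?_ ?_ ?_
    · refine ContinuousOn.sub ?_ ?_
      · exact continuousOn_finsetSum _ fun ω _ => continuousOn_finsetSum _ fun i _ =>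
          continuousOn_finsetSum _ fun j _ =>
            continuousOn_log_resolvent (ha ω i) (hb ω j) (hs ω i j)
      · exact continuousOn_finsetSum _ fun i _ => continuousOn_finsetSum _ fun j _ =>
          continuousOn_log_resolvent (ha₀ i) (hb₀ j) (hs₀ i j)
    · rw [interior_Ici]
      exact fun t ht => (hderiv t ht).differentiableAt.differentiableWithinAt
    · rw [interior_Ici]
      intro t ht
      rw [(hderiv t ht).deriv, sub_nonneg]
      obtain ⟨X, hX⟩ := exists_resolventFunctional_eq ht hU₀ hW₀ ha₀ hb₀
      rw [← hX, ← hA₀, ← hB₀, resolventFunctional_sum]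
      refine Finset.sum_le_sum fun ω _ => ?_
      rw [hAeq ω, hBeq ω]
      exact resolventFunctional_le ht (hU ω) (hW ω) (hW' ω) (ha ω) (hb ω) X
  have hnonneg : ∀ s, 0 ≤ s → 0 ≤ (∑ ω, g ω s) - g₀ s := fun s hs' => by
    simpa [g, g₀] using hmono (Set.mem_Ici.mpr le_rfl) (Set.mem_Ici.mpr hs') hs'
  have hlim : Tendsto (fun s => (∑ ω, g ω s) - g₀ s) atTop
      (𝓝 ((∑ ω, qRelEntropy (A ω) (B ω)) - qRelEntropy (∑ ω, A ω) (∑ ω, B ω))) := by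
    have hq₀ := qRelEntropy_spectralForm (a := a₀) (b := b₀) hU₀ hU₀' hW₀ hW₀'
    have hq := fun ω =>
      qRelEntropy_spectralForm (a := a ω) (b := b ω) (hU ω) (hU' ω) (hW ω) (hW' ω)
    rw [← hA₀, ← hB₀] at hq₀
    simp only [← hAeq, ← hBeq] at hq
    simp only [hq₀, hq]
    refine ((tendsto_finsetSum _ fun ω _ => tendsto_finsetSum _ fun i _ =>
      tendsto_finsetSum _ fun j _ => tendsto_log_resolvent (ha ω i) (hb ω j)).sub
      (tendsto_finsetSum _ fun i _ => tendsto_finsetSum _ fun j _ =>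
        tendsto_log_resolvent (ha₀ i) (hb₀ j))).congr fun s => ?_
    have htr : ∑ ω, ∑ i, ∑ j, overlap (U ω) (W ω) i j * a ω i =
        ∑ i, ∑ j, overlap U₀ W₀ i j * a₀ i := by
      rw [← trace_spectralForm hU₀ hW₀', ← hA₀, trace_sum, Complex.re_sum]
      refine Finset.sum_congr rfl fun ω _ => ?_
      rw [← trace_spectralForm (hU ω) (hW' ω), ← hAeq]
    simp only [Finset.sum_sub_distrib, ← Finset.mul_sum, htr, g, g₀]
    ring
  have := ge_of_tendsto hlim (eventually_ge_atTop 0 |>.mono hnonneg)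
  linarith

theorem mul_qRelEntropy_smul {A B : Matrix (Fin d) (Fin d) ℂ} (hA : A.PosSemidef)
    (hB : B.PosSemidef) (hker : ∀ v, B *ᵥ v = 0 → A *ᵥ v = 0) {q : ℝ}
    (hp : 0 < A.trace.re) (hq : 0 < q) :
    A.trace.re * Real.log (A.trace.re / q) +
      A.trace.re * qRelEntropy (A.trace.re⁻¹ • A) (q⁻¹ • B) = qRelEntropy A B := by
  obtain ⟨U, a, hU, hU', ha, hAeq⟩ := hA.exists_spectralForm
  obtain ⟨W, b, hW, hW', hb, hBeq⟩ := hB.exists_spectralForm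
  have hs : ∀ i j, b j = 0 → overlap U W i j * a i = 0 := fun i j hj =>
    overlap_mul_eq_zero_of_ker_le hU hW (by rwa [← hAeq, ← hBeq]) hj
  have htr := trace_spectralForm hU hW' a
  rw [← hAeq] at htr
  generalize A.trace.re = p at hp htr
  rw [hAeq, hBeq, smul_spectralForm, smul_spectralForm, qRelEntropy_spectralForm hU hU' hW hW',
    qRelEntropy_spectralForm hU hU' hW hW']
  nth_rewrite 1 [htr]
  simp only [Finset.sum_mul, Finset.mul_sum, ← Finset.sum_add_distrib]
  refine Finset.sum_congr rfl fun i _ => Finset.sum_congr rfl fun j _ => ?_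
  by_cases hw : overlap U W i j * a i = 0
  · have : p * (overlap U W i j * (p⁻¹ * a i *
        (Real.log (p⁻¹ * a i) - Real.log (q⁻¹ * b j)))) = overlap U W i j * a i *
        (p * (p⁻¹ * (Real.log (p⁻¹ * a i) - Real.log (q⁻¹ * b j)))) := by ring
    rw [this, ← mul_assoc (overlap U W i j) (a i), hw]
    simp
  · have hai : a i ≠ 0 := right_ne_zero_of_mul hw
    have hbj : b j ≠ 0 := fun h => hw (hs i j h)
    rw [Real.log_mul (inv_ne_zero hp.ne') hai, Real.log_mul (inv_ne_zero hq.ne') hbj,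
      Real.log_div hp.ne' hq.ne', Real.log_inv, Real.log_inv]
    field_simp
    ring

end Subadditivity

section Instrument

variable {d : ℕ} {Ω K : Type*} [Fintype K] (V : Ω → K → Matrix (Fin d) (Fin d) ℂ) (ω : Ω)

theorem posSemidef_instrOp {ρ : Matrix (Fin d) (Fin d) ℂ} (hρ : ρ.PosSemidef) :
    (instrOp V ω ρ).PosSemidef :=
  posSemidef_sum _ fun k _ => hρ.mul_mul_conjTranspose_same (V ω k)

theorem trace_instrOp_re (ρ : Matrix (Fin d) (Fin d) ℂ) :
    (instrOp V ω ρ).trace.re = outcomeProb V ρ ω := by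
  simp only [outcomeProb, instrOp, instrPOV, Matrix.sum_mul, trace_sum]
  congr 1
  refine Finset.sum_congr rfl fun k _ => ?_
  rw [Matrix.trace_mul_comm, Matrix.mul_assoc]

theorem instrOp_mulVec_eq_zero (ρ : Matrix (Fin d) (Fin d) ℂ) {φ : Matrix (Fin d) (Fin d) ℂ}
    (hφ : φ.PosDef) {v : Fin d → ℂ} (hv : instrOp V ω φ *ᵥ v = 0) :
    instrOp V ω ρ *ᵥ v = 0 := by
  have hpos := fun k => hφ.posSemidef.mul_mul_conjTranspose_same (V ω k)
  have h1 : ∑ k, star v ⬝ᵥ ((V ω k * φ * (V ω k)ᴴ) *ᵥ v) = 0 := by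
    rw [← dotProduct_sum, ← Matrix.sum_mulVec]
    rw [instrOp] at hv
    rw [hv, dotProduct_zero]
  rw [Finset.sum_eq_zero_iff_of_nonneg fun k _ => (hpos k).dotProduct_mulVec_nonneg v] at h1
  rw [instrOp, Matrix.sum_mulVec]
  refine Finset.sum_eq_zero fun k hk => ?_
  have h2 : (V ω k)ᴴ *ᵥ v = 0 := by
    by_contra hne
    have h3 := hφ.dotProduct_mulVec_pos hne
    rw [star_mulVec, conjTranspose_conjTranspose, dotProduct_mulVec, vecMul_vecMul,
      ← dotProduct_mulVec, mulVec_mulVec, h1 k hk] at h3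
    exact lt_irrefl _ h3
  rw [← mulVec_mulVec, h2, mulVec_zero]

end Instrument

/-- coarse graining by the a priori state channel `I(Ω)`. -/
theorem aposteriori_relative_entropy_ge_apriori {d : ℕ} (hd : 1 ≤ d)
    {Ω K : Type*} [Fintype Ω] [Fintype K]
    (V : Ω → K → Matrix (Fin d) (Fin d) ℂ)
    (hV : ∑ ω, instrPOV V ω = 1)
    (ρ φ : Matrix (Fin d) (Fin d) ℂ)
    (hρ : ρ.PosSemidef) (hρtr : ρ.trace = 1)
    (hφ : φ.PosDef) (hφtr : φ.trace = 1) :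
    cRelEntropy (outcomeProb V ρ) (outcomeProb V φ) +
        ∑ ω ∈ Finset.univ.filter (fun ω => 0 < outcomeProb V ρ ω),
          outcomeProb V ρ ω * qRelEntropy (postState V ρ ω) (postState V φ ω) ≥
      qRelEntropy (∑ ω, instrOp V ω ρ) (∑ ω, instrOp V ω φ) := by
  have hA := fun ω => posSemidef_instrOp V ω hρ
  have hB := fun ω => posSemidef_instrOp V ω hφ.posSemidef
  have hker : ∀ ω v, instrOp V ω φ *ᵥ v = 0 → instrOp V ω ρ *ᵥ v = 0 :=
    fun ω v hv => instrOp_mulVec_eq_zero V ω ρ hφ hv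
  have hzero : ∀ {A : Matrix (Fin d) (Fin d) ℂ}, A.PosSemidef → ¬ 0 < A.trace.re → A = 0 := by
    intro A hA' h
    have h0 := Complex.le_def.mp hA'.trace_nonneg
    refine hA'.trace_eq_zero_iff.mp (Complex.ext ?_ h0.2.symm)
    exact le_antisymm (not_lt.mp h) h0.1
  refine (qRelEntropy_sum_le hA hB hker).trans_eq ?_
  rw [cRelEntropy, ← Finset.sum_add_distrib, Finset.sum_filter]
  refine Finset.sum_congr rfl fun ω _ => ?_
  split_ifs with hp
  · rw [← trace_instrOp_re] at hp
    have hq : 0 < outcomeProb V φ ω := by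
      rw [← trace_instrOp_re]
      by_contra h
      have hA0 : instrOp V ω ρ = 0 := by
        refine Matrix.ext_of_mulVec_single fun i => ?_
        rw [hker ω _ (by rw [hzero (hB ω) h, zero_mulVec]), zero_mulVec]
      simp [hA0] at hp
    rw [postState, postState, ← trace_instrOp_re V ω ρ]
    exact (mul_qRelEntropy_smul (hA ω) (hB ω) (hker ω) hp hq).symm
  · rw [← trace_instrOp_re] at hp
    simp [hzero (hA ω) hp, qRelEntropy]
end

section
/- (Holevo's bound.) Let {p_i, ρ_i} be an ensemble of letter states on a finite alphabet A with average state η_i, and let E be any POV measure with finite outcome set Ω on M_d. Then the classical mutual information satisfies I_c{p_i, ρ_i; E} ≤ χ{p_i, ρ_i}, where χ{p_i, ρ_i} = Σ_{α: p_i(α)>0} p_i(α) S_q(ρ_i(α)‖η_i) is Holevo's χ-quantity. -/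
open Matrix Finset
open scoped BigOperators ComplexOrder

open Filter Topology

/-- The function `t ↦ w r (log (s + t r) - log s)` interpolates between the quadratic quantity
`w r² / (s + t r)` (its derivative) and the relative entropy term `w r (log r - log s)`. -/
lemma hasDerivAt_logGap {w r s t : ℝ} (hr : 0 ≤ r) (h : w * r ≠ 0 → 0 < s)
    (ht : 0 ≤ t) :
    HasDerivAt (fun t => w * r * (Real.log (s + t * r) - Real.log s))
      (w * (r ^ 2 / (s + t * r))) t := by
  by_cases hwr : w * r = 0
  · have h0 : w * (r ^ 2 / (s + t * r)) = 0 := by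
      rw [← mul_div_assoc, pow_two, ← mul_assoc, hwr]; simp
    rw [h0]
    simpa [hwr] using hasDerivAt_const t (0 : ℝ)
  · have hs' := h hwr
    have hpos : s + t * r ≠ 0 := by positivity
    have h1 : HasDerivAt (fun t => s + t * r) r t := by
      simpa using ((hasDerivAt_id t).mul_const r).const_add s
    have h2 := ((h1.log hpos).sub_const (Real.log s)).const_mul (w * r)
    exact h2.congr_deriv (by ring)

lemma tendsto_logGap {w r s : ℝ} (hr : 0 ≤ r) (h : w * r ≠ 0 → 0 < s) :
    Tendsto (fun t => w * r * (Real.log (s + t * r) - Real.log s) - w * r * Real.log t) atTop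
      (𝓝 (w * r * (Real.log r - Real.log s))) := by
  by_cases hwr : w * r = 0
  · simp [hwr]
  · have hs := h hwr
    have hr' : 0 < r := lt_of_le_of_ne hr fun h0 => hwr (by simp [← h0])
    have h1 : Tendsto (fun t : ℝ => s / t + r) atTop (𝓝 (0 + r)) :=
      (tendsto_const_nhds.div_atTop tendsto_id).add tendsto_const_nhds
    have h2 := (((Real.continuousAt_log (by simpa using hr'.ne')).tendsto.comp h1).sub_const
      (Real.log s)).const_mul (w * r)
    rw [zero_add] at h2
    refine h2.congr' ?_
    filter_upwards [eventually_gt_atTop 0] with t ht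
    have : s + t * r = t * (s / t + r) := by field_simp
    rw [this, Real.log_mul ht.ne' (by positivity)]
    simp only [Function.comp_apply]
    ring

/-- Comparing the quadratic quantities for all `t > 0` compares the relative entropies. -/
lemma sum_mul_log_sub_le {ι κ : Type*} [Fintype ι] [Fintype κ]
    {w r s : ι → ℝ} {p q : κ → ℝ} (hr : ∀ i, 0 ≤ r i) (hp : ∀ k, 0 ≤ p k)
    (hrs : ∀ i, w i * r i ≠ 0 → 0 < s i) (hpq : ∀ k, p k ≠ 0 → 0 < q k)
    (hsum : ∑ i, w i * r i = ∑ k, p k)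
    (h : ∀ t, 0 < t → ∑ k, p k ^ 2 / (q k + t * p k) ≤ ∑ i, w i * (r i ^ 2 / (s i + t * r i))) :
    ∑ k, p k * (Real.log (p k) - Real.log (q k)) ≤
      ∑ i, w i * r i * (Real.log (r i) - Real.log (s i)) := by
  have hpq' : ∀ k, (1 : ℝ) * p k ≠ 0 → 0 < q k := fun k hk => hpq k (by simpa using hk)
  let F : ℝ → ℝ := fun t => ∑ i, w i * r i * (Real.log (s i + t * r i) - Real.log (s i))
    - ∑ k, 1 * p k * (Real.log (q k + t * p k) - Real.log (q k))
  have hF : ∀ t, 0 ≤ t → HasDerivAt F (∑ i, w i * (r i ^ 2 / (s i + t * r i))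
      - ∑ k, 1 * (p k ^ 2 / (q k + t * p k))) t := fun t ht =>
    (HasDerivAt.fun_sum fun i _ => hasDerivAt_logGap (hr i) (hrs i) ht).sub
      (HasDerivAt.fun_sum fun k _ => hasDerivAt_logGap (hp k) (hpq' k) ht)
  have hmono : MonotoneOn F (Set.Ici 0) := by
    refine monotoneOn_of_deriv_nonneg (convex_Ici 0)
      (fun t ht => (hF t ht).continuousAt.continuousWithinAt)
      (fun t ht => (hF t (interior_subset ht)).differentiableAt.differentiableWithinAt)
      fun t ht => ?_
    rw [interior_Ici] at ht
    rw [(hF t (le_of_lt ht)).deriv]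
    simpa using h t ht
  have hlim : Tendsto F atTop (𝓝 (∑ i, w i * r i * (Real.log (r i) - Real.log (s i))
      - ∑ k, 1 * p k * (Real.log (p k) - Real.log (q k)))) := by
    refine ((tendsto_finsetSum _ fun i _ => tendsto_logGap (hr i) (hrs i)).sub
      (tendsto_finsetSum _ fun k _ => tendsto_logGap (hp k) (hpq' k))).congr fun t => ?_
    simp only [Finset.sum_sub_distrib, ← Finset.sum_mul, hsum, one_mul, F]
    ring
  have hF0 : F 0 = 0 := by simp [F]
  have hnonneg : ∀ᶠ t in atTop, 0 ≤ F t := by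
    filter_upwards [eventually_ge_atTop 0] with t ht
    simpa [hF0] using hmono Set.self_mem_Ici ht ht
  simpa using ge_of_tendsto hlim hnonneg

lemma Matrix.PosSemidef.exists_spectral_matLog {d : ℕ} {A : Matrix (Fin d) (Fin d) ℂ}
    (hA : A.PosSemidef) :
    ∃ U ∈ unitaryGroup (Fin d) ℂ, ∃ r : Fin d → ℝ, (∀ i, 0 ≤ r i) ∧
      A = U * diagonal (fun i => (r i : ℂ)) * Uᴴ ∧
      matLog A = U * diagonal (fun i => (Real.log (r i) : ℂ)) * Uᴴ := by
  refine ⟨hA.1.eigenvectorUnitary, hA.1.eigenvectorUnitary.2, hA.1.eigenvalues,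
    hA.eigenvalues_nonneg, ?_, ?_⟩
  · exact hA.1.spectral_theorem
  · rw [matLog, dif_pos hA.1]
    rfl

lemma trace_unitary_conj {d : ℕ} {U : Matrix (Fin d) (Fin d) ℂ}
    (hU : U ∈ unitaryGroup (Fin d) ℂ) (A : Matrix (Fin d) (Fin d) ℂ) :
    (Uᴴ * A * U).trace = A.trace := by
  rw [trace_mul_comm, ← mul_assoc, ← star_eq_conjTranspose, mem_unitaryGroup_iff.mp hU, one_mul]

lemma trace_mul_diagonal_mul {d : ℕ} (Y M : Matrix (Fin d) (Fin d) ℂ) (r : Fin d → ℂ) :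
    (Y * diagonal r * M).trace = ∑ x : Fin d × Fin d, r x.1 * (Y x.2 x.1 * M x.1 x.2) := by
  rw [Fintype.sum_prod_type_right]
  simp only [trace, diag_apply, mul_apply (M := Y * diagonal r), mul_diagonal]
  exact Finset.sum_congr rfl fun _ _ => Finset.sum_congr rfl fun _ _ => by ring

lemma re_trace_mul_diagonal_mul_conjTranspose {d : ℕ} (Y : Matrix (Fin d) (Fin d) ℂ)
    (r : Fin d → ℝ) :
    (Y * diagonal (fun i => (r i : ℂ)) * Yᴴ).trace.re =
      ∑ x : Fin d × Fin d, r x.1 * Complex.normSq (Y x.2 x.1) := by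
  simp [trace_mul_diagonal_mul, Complex.mul_conj, ← Complex.ofReal_mul]

lemma re_trace_spectral_mul_spectral {d : ℕ} (U V : Matrix (Fin d) (Fin d) ℂ)
    (a b : Fin d → ℝ) :
    ((U * diagonal (fun i => (a i : ℂ)) * Uᴴ) *
        (V * diagonal (fun i => (b i : ℂ)) * Vᴴ)).trace.re =
      ∑ x : Fin d × Fin d, Complex.normSq ((Uᴴ * V) x.1 x.2) * (a x.1 * b x.2) := by
  have h : ((U * diagonal (fun i => (a i : ℂ)) * Uᴴ) *
        (V * diagonal (fun i => (b i : ℂ)) * Vᴴ)).trace =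
      ((diagonal (fun i => (b i : ℂ)) * (Uᴴ * V)ᴴ) * diagonal (fun i => (a i : ℂ)) *
        (Uᴴ * V)).trace := by
    rw [trace_mul_comm, ← trace_mul_comm (Uᴴ * V)]
    simp only [conjTranspose_mul, conjTranspose_conjTranspose, ← mul_assoc]
    rw [trace_mul_comm]
    simp only [← mul_assoc]
  rw [h, trace_mul_diagonal_mul, Complex.re_sum]
  refine Finset.sum_congr rfl fun x _ => ?_
  rw [diagonal_mul, conjTranspose_apply, mul_assoc, Complex.star_def,
    ← Complex.normSq_eq_conj_mul_self, ← Complex.ofReal_mul, ← Complex.ofReal_mul,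
    Complex.ofReal_re]
  ring

lemma Matrix.PosSemidef.re_trace_mul_nonneg {d : ℕ} {A B : Matrix (Fin d) (Fin d) ℂ}
    (hA : A.PosSemidef) (hB : B.PosSemidef) : 0 ≤ (A * B).trace.re := by
  obtain ⟨U, -, r, hr, rfl, -⟩ := hA.exists_spectral_matLog
  obtain ⟨V, -, s, hs, rfl, -⟩ := hB.exists_spectral_matLog
  rw [re_trace_spectral_mul_spectral]
  exact Finset.sum_nonneg fun x _ =>
    mul_nonneg (Complex.normSq_nonneg _) (mul_nonneg (hr _) (hs _))

lemma two_mul_re_mul_sub_le {y m : ℂ} {r s t : ℝ} (hr : 0 ≤ r) (hs : 0 ≤ s) (ht : 0 < t) :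
    2 * (r * (y * m).re) - s * Complex.normSq y - t * (r * Complex.normSq y) ≤
      Complex.normSq m * (r ^ 2 / (s + t * r)) := by
  rcases hr.eq_or_lt with rfl | hr
  · have := mul_nonneg hs (Complex.normSq_nonneg y)
    simp
    linarith
  · have hc : 0 < s + t * r := by positivity
    rw [← mul_div_assoc, le_div_iff₀ hc]
    simp only [Complex.normSq_apply, Complex.mul_re]
    nlinarith [sq_nonneg ((s + t * r) * y.re - r * m.re), sq_nonneg ((s + t * r) * y.im + r * m.im)]

lemma two_mul_re_trace_sub_le {d : ℕ} {U V : Matrix (Fin d) (Fin d) ℂ}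
    (hU : U ∈ unitaryGroup (Fin d) ℂ) (hV : V ∈ unitaryGroup (Fin d) ℂ)
    {r s : Fin d → ℝ} (hr : ∀ i, 0 ≤ r i) (hs : ∀ i, 0 ≤ s i)
    {ρ η : Matrix (Fin d) (Fin d) ℂ}
    (hρ : ρ = U * diagonal (fun i => (r i : ℂ)) * Uᴴ)
    (hη : η = V * diagonal (fun i => (s i : ℂ)) * Vᴴ)
    (X : Matrix (Fin d) (Fin d) ℂ) {t : ℝ} (ht : 0 < t) :
    2 * (X * ρ).trace.re - (Xᴴ * η * X).trace.re - t * (X * ρ * Xᴴ).trace.re ≤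
      ∑ x : Fin d × Fin d, Complex.normSq ((Uᴴ * V) x.1 x.2) *
        (r x.1 ^ 2 / (s x.2 + t * r x.1)) := by
  have h1 : (X * ρ).trace.re =
      ∑ x : Fin d × Fin d, r x.1 * ((Vᴴ * X * U) x.2 x.1 * (Uᴴ * V) x.1 x.2).re := by
    rw [← trace_unitary_conj hV, hρ]
    have : Vᴴ * (X * (U * diagonal (fun i => (r i : ℂ)) * Uᴴ)) * V =
        (Vᴴ * X * U) * diagonal (fun i => (r i : ℂ)) * (Uᴴ * V) := by
      simp only [mul_assoc]
    rw [this, trace_mul_diagonal_mul, Complex.re_sum]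
    simp only [Complex.re_ofReal_mul]
  have h2 : (Xᴴ * η * X).trace.re =
      ∑ x : Fin d × Fin d, s x.2 * Complex.normSq ((Vᴴ * X * U) x.2 x.1) := by
    rw [← trace_unitary_conj hU, hη]
    have : Uᴴ * (Xᴴ * (V * diagonal (fun i => (s i : ℂ)) * Vᴴ) * X) * U =
        (Vᴴ * X * U)ᴴ * diagonal (fun i => (s i : ℂ)) * (Vᴴ * X * U)ᴴᴴ := by
      simp only [mul_assoc, conjTranspose_mul, conjTranspose_conjTranspose]
    rw [this, re_trace_mul_diagonal_mul_conjTranspose, Fintype.sum_prod_type_right,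
      Fintype.sum_prod_type]
    simp only [conjTranspose_apply, Complex.star_def, Complex.normSq_conj]
  have h3 : (X * ρ * Xᴴ).trace.re =
      ∑ x : Fin d × Fin d, r x.1 * Complex.normSq ((Vᴴ * X * U) x.2 x.1) := by
    rw [← trace_unitary_conj hV, hρ, ← re_trace_mul_diagonal_mul_conjTranspose]
    simp only [mul_assoc, conjTranspose_mul, conjTranspose_conjTranspose]
  rw [h1, h2, h3, Finset.mul_sum, Finset.mul_sum, ← Finset.sum_sub_distrib,
    ← Finset.sum_sub_distrib]
  exact Finset.sum_le_sum fun x _ => two_mul_re_mul_sub_le (hr _) (hs _) ht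

/-- The operator Jensen inequality for the square, `(∑ ω, x ω E ω)² ≤ ∑ ω, (x ω)² E ω`,
traced against a positive matrix. -/
lemma re_trace_sq_mul_le {d : ℕ} {Ω : Type*} [Fintype Ω]
    {E : Ω → Matrix (Fin d) (Fin d) ℂ} (hE : ∀ ω, (E ω).PosSemidef) (hE1 : ∑ ω, E ω = 1)
    {B : Matrix (Fin d) (Fin d) ℂ} (hB : B.PosSemidef) (x : Ω → ℝ) :
    ((∑ ω, x ω • E ω) * (∑ ω, x ω • E ω) * B).trace.re ≤ ∑ ω, x ω ^ 2 * povProb E B ω := by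
  set X := ∑ ω, x ω • E ω with hX
  have hXh : Xᴴ = X := by
    simp only [hX, conjTranspose_sum, conjTranspose_smul, star_trivial, (hE _).1.eq]
  have hpos : (∑ ω, (x ω • 1 - X)ᴴ * E ω * (x ω • 1 - X)).PosSemidef :=
    posSemidef_sum _ fun ω _ => (hE ω).conjTranspose_mul_mul_same _
  have hexp : ∑ ω, (x ω • 1 - X)ᴴ * E ω * (x ω • 1 - X) = ∑ ω, x ω ^ 2 • E ω - X * X := by
    have hterm : ∀ ω, (x ω • 1 - X)ᴴ * E ω * (x ω • 1 - X) =
        x ω ^ 2 • E ω - (x ω • E ω) * X - X * (x ω • E ω) + X * E ω * X := fun ω => by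
      simp only [conjTranspose_sub, conjTranspose_smul, conjTranspose_one, star_trivial, hXh,
        sub_mul, mul_sub, smul_mul_assoc, mul_smul_comm, one_mul, mul_one, smul_sub, pow_two, mul_smul]
      abel
    simp only [hterm, Finset.sum_add_distrib, Finset.sum_sub_distrib, ← Finset.sum_mul,
      ← Finset.mul_sum, ← hX, hE1, mul_one]
    abel
  have := hpos.re_trace_mul_nonneg hB
  rw [hexp, sub_mul, trace_sub, Complex.sub_re, Finset.sum_mul, trace_sum, Complex.re_sum] at this
  simp only [smul_mul_assoc, trace_smul, Complex.smul_re, smul_eq_mul] at this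
  simpa only [povProb, sub_nonneg] using this

lemma povProb_nonneg {d : ℕ} {Ω : Type*} {E : Ω → Matrix (Fin d) (Fin d) ℂ}
    (hE : ∀ ω, (E ω).PosSemidef) {B : Matrix (Fin d) (Fin d) ℂ} (hB : B.PosSemidef) (ω : Ω) :
    0 ≤ povProb E B ω :=
  (hE ω).re_trace_mul_nonneg hB

/-- Relative entropy does not increase under a measurement. -/
lemma sum_povProb_log_le_qRelEntropy {d : ℕ} {Ω : Type*} [Fintype Ω]
    {E : Ω → Matrix (Fin d) (Fin d) ℂ} (hE : ∀ ω, (E ω).PosSemidef) (hE1 : ∑ ω, E ω = 1)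
    {ρ η : Matrix (Fin d) (Fin d) ℂ} (hρ : ρ.PosSemidef) (hη : η.PosSemidef)
    {c : ℝ} (hc : 0 < c) (hle : (η - c • ρ).PosSemidef) :
    ∑ ω, povProb E ρ ω * (Real.log (povProb E ρ ω) - Real.log (povProb E η ω)) ≤
      qRelEntropy ρ η := by
  obtain ⟨U, hU, r, hr, hρU, hlogρ⟩ := hρ.exists_spectral_matLog
  obtain ⟨V, hV, s, hs, hηV, hlogη⟩ := hη.exists_spectral_matLog
  have hVone : V * Vᴴ = 1 := mem_unitaryGroup_iff.mp hV
  have hVone' : Vᴴ * V = 1 := mem_unitaryGroup_iff'.mp hV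
  have hUone' : Uᴴ * U = 1 := mem_unitaryGroup_iff'.mp hU
  have hcancel : ∀ {W : Matrix (Fin d) (Fin d) ℂ}, Wᴴ * W = 1 → ∀ a b : Fin d → ℝ,
      (W * diagonal (fun i => (a i : ℂ)) * Wᴴ) * (W * diagonal (fun i => (b i : ℂ)) * Wᴴ) =
        W * diagonal (fun i => ((a i * b i : ℝ) : ℂ)) * Wᴴ := fun {W} hW a b => by
    have : (W * diagonal (fun i => (a i : ℂ)) * Wᴴ) *
        (W * diagonal (fun i => (b i : ℂ)) * Wᴴ) = W * (diagonal (fun i => (a i : ℂ)) *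
          (Wᴴ * W) * diagonal (fun i => (b i : ℂ))) * Wᴴ := by simp only [mul_assoc]
    rw [this, hW, mul_one, diagonal_mul_diagonal]
    simp only [Complex.ofReal_mul]
  have htrace : ∀ a : Fin d → ℝ, (U * diagonal (fun i => (a i : ℂ)) * Uᴴ).trace.re =
      ∑ x : Fin d × Fin d, Complex.normSq ((Uᴴ * V) x.1 x.2) * a x.1 := fun a => by
    simpa [hVone] using re_trace_spectral_mul_spectral U V a (fun _ => 1)
  have hdom : ∀ {B : Matrix (Fin d) (Fin d) ℂ}, B.PosSemidef →
      c * (ρ * B).trace.re ≤ (η * B).trace.re := fun hB => by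
    have := hle.re_trace_mul_nonneg hB
    rw [sub_mul, trace_sub, Complex.sub_re, smul_mul_assoc, trace_smul, Complex.smul_re,
      smul_eq_mul] at this
    linarith
  have hS : qRelEntropy ρ η = ∑ x : Fin d × Fin d, Complex.normSq ((Uᴴ * V) x.1 x.2) * r x.1 *
      (Real.log (r x.1) - Real.log (s x.2)) := by
    rw [qRelEntropy, mul_sub, trace_sub, Complex.sub_re, hlogρ, hlogη, hρU, hcancel hUone',
      htrace, re_trace_spectral_mul_spectral, ← Finset.sum_sub_distrib]
    exact Finset.sum_congr rfl fun _ _ => by ring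
  rw [hS]
  refine sum_mul_log_sub_le (fun _ => hr _) (povProb_nonneg hE hρ) ?_ ?_ ?_ ?_
  · rintro ⟨i, j⟩ hij
    have hsingle : 0 ≤ (Pi.single j 1 : Fin d → ℝ) := Pi.single_nonneg.mpr zero_le_one
    refine lt_of_lt_of_le ?_ ((hdom (B := V * diagonal
      (fun k => ((Pi.single j 1 : Fin d → ℝ) k : ℂ)) * Vᴴ) ?_).trans (le_of_eq ?_))
    · rw [hρU, re_trace_spectral_mul_spectral]
      have hnn : ∀ x : Fin d × Fin d, 0 ≤ Complex.normSq ((Uᴴ * V) x.1 x.2) *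
          (r x.1 * (Pi.single j 1 : Fin d → ℝ) x.2) := fun x =>
        mul_nonneg (Complex.normSq_nonneg _) (mul_nonneg (hr _) (hsingle _))
      refine mul_pos hc (Finset.sum_pos' (fun x _ => hnn x) ⟨(i, j), Finset.mem_univ _, ?_⟩)
      exact lt_of_le_of_ne (hnn _) (by simpa using hij.symm)
    · refine PosSemidef.mul_mul_conjTranspose_same (posSemidef_diagonal_iff.mpr fun k => ?_) V
      exact Complex.zero_le_real.mpr (hsingle k)
    · rw [hηV, hcancel hVone']
      have h := trace_unitary_conj hV (V * diagonal
        (fun i => ((s i * (Pi.single j 1 : Fin d → ℝ) i : ℝ) : ℂ)) * Vᴴ)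
      rw [← h]
      simp only [← mul_assoc, hVone', one_mul]
      rw [mul_assoc, hVone', mul_one, trace_diagonal, Complex.re_sum]
      simp [Pi.single_apply]
  · intro ω hω
    have h1 := hdom (hE ω)
    rw [trace_mul_comm ρ, trace_mul_comm η] at h1
    have h2 := (povProb_nonneg hE hρ ω).lt_of_ne' hω
    exact (mul_pos hc h2).trans_le h1
  · rw [← htrace, ← hρU]
    simp only [povProb]
    rw [← Complex.re_sum, ← trace_sum, ← Finset.sum_mul, hE1, one_mul]
  · intro t ht
    set x : Ω → ℝ := fun ω => povProb E ρ ω / (povProb E η ω + t * povProb E ρ ω)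
    set X := ∑ ω, x ω • E ω with hX
    have hXh : Xᴴ = X := by
      simp only [hX, conjTranspose_sum, conjTranspose_smul, star_trivial, (hE _).1.eq]
    refine le_trans ?_ (two_mul_re_trace_sub_le hU hV hr hs hρU hηV X ht)
    have h1 : (X * ρ).trace.re = ∑ ω, x ω * povProb E ρ ω := by
      simp [hX, povProb, Finset.sum_mul, trace_sum]
    have h2 : (Xᴴ * η * X).trace.re = (X * X * η).trace.re := by
      rw [hXh, trace_mul_comm, ← mul_assoc]
    have h3 : (X * ρ * Xᴴ).trace.re = (X * X * ρ).trace.re := by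
      rw [hXh, trace_mul_comm, ← mul_assoc]
    have hη2 := re_trace_sq_mul_le hE hE1 hη x
    have hρ2 := mul_le_mul_of_nonneg_left (re_trace_sq_mul_le hE hE1 hρ x) ht.le
    rw [h1, h2, h3]
    have key : ∑ ω, povProb E ρ ω ^ 2 / (povProb E η ω + t * povProb E ρ ω) =
        2 * ∑ ω, x ω * povProb E ρ ω - ∑ ω, x ω ^ 2 * povProb E η ω
          - t * ∑ ω, x ω ^ 2 * povProb E ρ ω := by
      rw [Finset.mul_sum, Finset.mul_sum, ← Finset.sum_sub_distrib, ← Finset.sum_sub_distrib]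
      refine Finset.sum_congr rfl fun ω _ => ?_
      by_cases h0 : povProb E η ω + t * povProb E ρ ω = 0
      · simp [x, h0]
      · simp only [x]
        generalize hD : povProb E η ω + t * povProb E ρ ω = D at h0 ⊢
        rw [eq_sub_of_add_eq hD]
        field_simp
        ring
    rw [key]
    linarith

/-- Holevo's bound. -/
theorem holevo_bound {d : ℕ} (hd : 1 ≤ d)
    {A Ω : Type*} [Fintype A] [Fintype Ω]
    (p : A → ℝ) (hp : ∀ α, 0 ≤ p α) (hp1 : ∑ α, p α = 1)
    (ρ : A → Matrix (Fin d) (Fin d) ℂ)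
    (hρ : ∀ α, (ρ α).PosSemidef) (hρtr : ∀ α, (ρ α).trace = 1)
    (E : Ω → Matrix (Fin d) (Fin d) ℂ)
    (hEpos : ∀ ω, (E ω).PosSemidef) (hEsum : ∑ ω, E ω = 1) :
    mutualInfo p ρ E ≤ chiQuantity p ρ := by
  set η := ∑ α, p α • ρ α with hη
  have hηpos : η.PosSemidef := posSemidef_sum _ fun α _ => (hρ α).smul (hp α)
  have hle : ∀ α, (η - p α • ρ α).PosSemidef := fun α => by
    classical
    rw [hη, ← Finset.add_sum_erase _ _ (Finset.mem_univ α), add_sub_cancel_left]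
    exact posSemidef_sum _ fun β _ => (hρ β).smul (hp β)
  have hI : mutualInfo p ρ E = ∑ α ∈ Finset.univ.filter (fun α => 0 < p α), p α *
      ∑ ω, povProb E (ρ α) ω * (Real.log (povProb E (ρ α) ω) - Real.log (povProb E η ω)) := by
    rw [mutualInfo, Finset.sum_filter, Finset.sum_filter, Fintype.sum_prod_type]
    refine Finset.sum_congr rfl fun α _ => ?_
    split_ifs with hα
    · rw [Finset.mul_sum]
      refine Finset.sum_congr rfl fun ω _ => ?_
      dsimp only
      rw [← hη]
      have h0 := povProb_nonneg hEpos (hρ α) ω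
      rcases h0.eq_or_lt with h | h
      · simp [← h]
      · have hηω : povProb E η ω ≠ 0 := by
          have h1 := (hEpos ω).re_trace_mul_nonneg (hle α)
          rw [mul_sub, trace_sub, Complex.sub_re, mul_smul_comm, trace_smul, Complex.smul_re,
            smul_eq_mul] at h1
          have h2 : 0 < p α * povProb E (ρ α) ω := mul_pos hα h
          simp only [povProb] at h2 ⊢
          linarith
        rw [if_pos (mul_pos hα h), mul_div_mul_left _ _ hα.ne', Real.log_div h.ne' hηω, mul_assoc]
    · have : p α = 0 := le_antisymm (not_lt.mp hα) (hp α)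
      simp [this]
  rw [hI, chiQuantity]
  refine Finset.sum_le_sum fun α hα => mul_le_mul_of_nonneg_left ?_ (hp α)
  exact sum_povProb_log_le_qRelEntropy hEpos hEsum (hρ α) hηpos (Finset.mem_filter.mp hα).2 (hle α)
end
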